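/- Let u ∈ L^1(Q), let (ℬ_n) be a sequence of linear differential operators of order at most d, and let ℬ be a linear differential operator of order at most d such that ℬ_n → ℬ in ℓ∞. Then liminf_{n→∞} PV_{ℬ_n}(u) ≥ PV_ℬ(u). -/

import Mathlib

open MeasureTheory Filter Topology ENNReal
open scoped Classical

noncomputable section

/-- The open unit cube `(0,1)^N` in `ℝ^N`. -/
def Qset (N : ℕ) : Set (Fin N → ℝ) := Set.univ.pi fun _ => Set.Ioo (0:ℝ) 1

/-- Index type for `ℝ^K`, where `K = ∑_{h=1}^d N^h`. -/
def Kidx (N d : ℕ) : Type := (h : Fin d) × ((Fin (h.1 + 1)) → Fin N)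

instance (N d : ℕ) : Fintype (Kidx N d) := by unfold Kidx; infer_instance
instance (N d : ℕ) : DecidableEq (Kidx N d) := by unfold Kidx; infer_instance

/-- A linear differential operator of order at most `d`, given by coefficient
matrices `B^h : ℝ^{N^h} → ℝ^{N^h}` for `h = 1, …, d`.  (Here `h : Fin d`
corresponds to the order `h+1` term.) -/
structure DiffOp (N d : ℕ) where
  B : ∀ h : Fin d, Matrix ((Fin (h.1 + 1)) → Fin N) ((Fin (h.1 + 1)) → Fin N) ℝ

/-- Iterated directional derivative of order `h` of `u` in the coordinate
directions prescribed by `j`; the component `j` of the `h`-th Hessian `H^h u`. -/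
def iterD {N : ℕ} (u : (Fin N → ℝ) → ℝ) (h : ℕ) (j : Fin h → Fin N)
    (x : Fin N → ℝ) : ℝ :=
  iteratedFDeriv ℝ h u x fun i => Pi.single (j i) 1

/-- `ℬ u = ∑_h B^h (H^h u)`, defined pointwise for (smooth) `u`. -/
def opApply {N d : ℕ} (L : DiffOp N d) (u : (Fin N → ℝ) → ℝ)
    (x : Fin N → ℝ) : Kidx N d → ℝ :=
  fun k => ∑ j', L.B k.1 k.2 j' * iterD u (k.1.1 + 1) j' x

/-- The formal adjoint `ℬ* φ` applied to a test field `φ`: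
`ℬ*φ = ∑_h (-1)^h ∑_j ∂^h_j ((B^h)ᵀ φ^h)_j`. -/
def adjApply {N d : ℕ} (L : DiffOp N d) (φ : (Fin N → ℝ) → Kidx N d → ℝ)
    (x : Fin N → ℝ) : ℝ :=
  ∑ h : Fin d, (-1 : ℝ) ^ (h.1 + 1) *
    ∑ j : Fin (h.1 + 1) → Fin N,
      iterD (fun y => ∑ j', L.B h j' j * φ y ⟨h, j'⟩) (h.1 + 1) j x

/-- `φ ∈ C_c^∞(Q; ℝ^K)` (smooth, compactly supported inside `Q`). -/
def IsTest {N : ℕ} {E : Type*} [NormedAddCommGroup E] [NormedSpace ℝ E]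
    (φ : (Fin N → ℝ) → E) : Prop :=
  ContDiff ℝ (⊤ : ℕ∞) φ ∧ HasCompactSupport φ ∧ tsupport φ ⊆ Qset N

/-- Square of the Euclidean norm on `ℝ^K`. -/
def sqNorm {N d : ℕ} (v : Kidx N d → ℝ) : ℝ := ∑ k, (v k) ^ 2

/-- The PDE-constraint seminorm
`PV_ℬ(u) = sup { ∫_Q u ℬ*φ dx : φ ∈ C_c^∞(Q;ℝ^K), |φ| ≤ 1 }` (valued in `[0,∞]`). -/
def PV {N d : ℕ} (L : DiffOp N d) (u : (Fin N → ℝ) → ℝ) : ℝ≥0∞ :=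
  ⨆ φ : {φ : (Fin N → ℝ) → Kidx N d → ℝ // IsTest φ ∧ ∀ x, sqNorm (φ x) ≤ 1},
    ENNReal.ofReal (∫ x in Qset N, u x * adjApply L (φ : (Fin N → ℝ) → Kidx N d → ℝ) x)

/-- The `ℓ∞` (entrywise sup) norm of a matrix. -/
def matSup {ι : Type*} [Fintype ι] (M : Matrix ι ι ℝ) : ℝ := ⨆ i, ⨆ j, |M i j|

/-- `|ℬ − ℬ'|_{ℓ∞} := ∑_h |B^h − B'^h|_{ℓ∞}`. -/
def opDist {N d : ℕ} (L L' : DiffOp N d) : ℝ := ∑ h, matSup (L.B h - L'.B h)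

end

section
noncomputable section

theorem abs_le_matSup {ι : Type*} [Fintype ι] (M : Matrix ι ι ℝ) (i j : ι) :
    |M i j| ≤ matSup M :=
  (le_ciSup (Set.finite_range fun j => |M i j|).bddAbove j).trans
    (le_ciSup (f := fun i => ⨆ j, |M i j|) (Set.finite_range _).bddAbove i)

theorem matSup_nonneg {ι : Type*} [Fintype ι] (M : Matrix ι ι ℝ) : 0 ≤ matSup M :=
  Real.iSup_nonneg fun _ => Real.iSup_nonneg fun _ => abs_nonneg _

theorem abs_coeff_sub_le_opDist {N d : ℕ} (L L' : DiffOp N d) (h : Fin d)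
    (i j : Fin (h.1 + 1) → Fin N) : |L.B h i j - L'.B h i j| ≤ opDist L L' :=
  (abs_le_matSup (L.B h - L'.B h) i j).trans
    (Finset.single_le_sum (f := fun h => matSup (L.B h - L'.B h))
      (fun _ _ => matSup_nonneg _) (Finset.mem_univ h))

/-- Convergence of operators in `ℓ∞` implies convergence of every coefficient. -/
theorem tendsto_coeff_of_opDist {N d : ℕ} {L : ℕ → DiffOp N d} {L₀ : DiffOp N d}
    (hL : Tendsto (fun n => opDist (L n) L₀) atTop (𝓝 0)) (h : Fin d)
    (i j : Fin (h.1 + 1) → Fin N) :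
    Tendsto (fun n => (L n).B h i j) atTop (𝓝 (L₀.B h i j)) :=
  tendsto_iff_norm_sub_tendsto_zero.2 <|
    squeeze_zero (fun _ => norm_nonneg _)
      (fun n => abs_coeff_sub_le_opDist (L n) L₀ h i j) hL

theorem IsTest.contDiff_apply {N : ℕ} {ι : Type*} [Fintype ι] {φ : (Fin N → ℝ) → ι → ℝ}
    (hφ : IsTest φ) (k : ι) : ContDiff ℝ (⊤ : ℕ∞) fun y => φ y k :=
  contDiff_pi.1 hφ.1 k

theorem IsTest.hasCompactSupport_apply {N : ℕ} {ι : Type*} [Fintype ι]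
    {φ : (Fin N → ℝ) → ι → ℝ} (hφ : IsTest φ) (k : ι) :
    HasCompactSupport fun y => φ y k :=
  hφ.2.1.comp_left (g := fun v : ι → ℝ => v k) rfl

theorem iterD_sum_mul {N h : ℕ} {ι : Type*} [Fintype ι] (c : ι → ℝ)
    {f : ι → (Fin N → ℝ) → ℝ} (hf : ∀ i, ContDiff ℝ (⊤ : ℕ∞) (f i))
    (j : Fin h → Fin N) (x : Fin N → ℝ) :
    iterD (fun y => ∑ i, c i * f i y) h j x = ∑ i, c i * iterD (f i) h j x := by
  have hf' : ∀ i, ContDiff ℝ h (f i) := fun i => (hf i).of_le (by exact_mod_cast le_top)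
  unfold iterD
  rw [iteratedFDeriv_fun_sum_apply (u := Finset.univ) (f := fun i y => c i * f i y)
    fun i _ => (contDiff_const.mul (hf' i)).contDiffAt]
  simp only [sum_apply]
  refine Finset.sum_congr rfl fun i _ => ?_
  simpa [smul_eq_mul] using congrArg
    (fun T => T fun i => Pi.single (j i) (1 : ℝ))
    (iteratedFDeriv_const_smul_apply' (a := c i) (hf' i).contDiffAt (x := x))

theorem continuous_iterD {N h : ℕ} {f : (Fin N → ℝ) → ℝ} (hf : ContDiff ℝ (⊤ : ℕ∞) f)
    (j : Fin h → Fin N) : Continuous (iterD f h j) := by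
  have := hf.continuous_iteratedFDeriv (m := h) (by exact_mod_cast le_top)
  unfold iterD
  fun_prop

theorem HasCompactSupport.iterD {N h : ℕ} {f : (Fin N → ℝ) → ℝ} (hf : HasCompactSupport f)
    (j : Fin h → Fin N) : HasCompactSupport (iterD f h j) :=
  (hf.iteratedFDeriv (𝕜 := ℝ) h).comp_left
    (g := fun T : ContinuousMultilinearMap ℝ (fun _ : Fin h => Fin N → ℝ) ℝ =>
      T fun i => Pi.single (j i) 1) rfl

theorem integrableOn_mul_iterD {N h : ℕ} {u f : (Fin N → ℝ) → ℝ} {s : Set (Fin N → ℝ)}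
    (hu : IntegrableOn u s volume) (hf : ContDiff ℝ (⊤ : ℕ∞) f) (hc : HasCompactSupport f)
    (j : Fin h → Fin N) : IntegrableOn (fun x => u x * iterD f h j x) s volume := by
  obtain ⟨C, hC⟩ := (hc.iterD j).exists_bound_of_continuous (continuous_iterD hf j)
  exact Integrable.mul_bdd hu (continuous_iterD hf j).aestronglyMeasurable
    (Eventually.of_forall hC)

/-- The pairing of `u` with `ℬ*φ` is linear in the coefficients of `ℬ`. -/
theorem integral_mul_adjApply {N d : ℕ} (L : DiffOp N d) {u : (Fin N → ℝ) → ℝ}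
    (hu : IntegrableOn u (Qset N) volume) {φ : (Fin N → ℝ) → Kidx N d → ℝ} (hφ : IsTest φ) :
    ∫ x in Qset N, u x * adjApply L φ x =
      ∑ h : Fin d, ∑ j : Fin (h.1 + 1) → Fin N, ∑ j' : Fin (h.1 + 1) → Fin N,
        L.B h j' j * ((-1 : ℝ) ^ (h.1 + 1) *
          ∫ x in Qset N, u x * iterD (fun y => φ y ⟨h, j'⟩) (h.1 + 1) j x) := by
  have hi : ∀ (h : Fin d) (j j' : Fin (h.1 + 1) → Fin N), IntegrableOn
      (fun x => L.B h j' j * ((-1 : ℝ) ^ (h.1 + 1) *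
        (u x * iterD (fun y => φ y ⟨h, j'⟩) (h.1 + 1) j x))) (Qset N) volume := fun h j j' =>
    ((integrableOn_mul_iterD hu (hφ.contDiff_apply _) (hφ.hasCompactSupport_apply _) j).const_mul
      _).const_mul _
  have hadj : ∀ x, u x * adjApply L φ x =
      ∑ h : Fin d, ∑ j : Fin (h.1 + 1) → Fin N, ∑ j' : Fin (h.1 + 1) → Fin N,
        L.B h j' j * ((-1 : ℝ) ^ (h.1 + 1) *
          (u x * iterD (fun y => φ y ⟨h, j'⟩) (h.1 + 1) j x)) := fun x => by
    simp only [adjApply, Finset.mul_sum]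
    refine Finset.sum_congr rfl fun h _ => Finset.sum_congr rfl fun j _ => ?_
    rw [iterD_sum_mul (fun j' => L.B h j' j) fun j' => hφ.contDiff_apply ⟨h, j'⟩]
    simp only [Finset.mul_sum]
    exact Finset.sum_congr rfl fun j' _ => by ring
  simp only [hadj]
  rw [integral_finsetSum _ fun h _ => integrable_finsetSum _ fun j _ =>
    integrable_finsetSum _ fun j' _ => hi h j j']
  refine Finset.sum_congr rfl fun h _ => ?_
  rw [integral_finsetSum _ fun j _ => integrable_finsetSum _ fun j' _ => hi h j j']
  refine Finset.sum_congr rfl fun j _ => ?_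
  rw [integral_finsetSum _ fun j' _ => hi h j j']
  simp only [integral_const_mul]

/-- lower semicontinuity of `PV` with respect to the operator:
if `ℬₙ → ℬ` in `ℓ∞` then `liminf PV_{ℬₙ}(u) ≥ PV_ℬ(u)` for every `u ∈ L¹(Q)`. -/
theorem PV_lsc_op {N d : ℕ} (L : ℕ → DiffOp N d) (L₀ : DiffOp N d)
    (u : (Fin N → ℝ) → ℝ) (hu : IntegrableOn u (Qset N) volume)
    (hL : Tendsto (fun n => opDist (L n) L₀) atTop (𝓝 0)) :
    PV L₀ u ≤ atTop.liminf fun n => PV (L n) u := by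
  refine iSup_le fun φ => ?_
  have hlim : Tendsto (fun n => ENNReal.ofReal (∫ x in Qset N, u x * adjApply (L n) φ.1 x)) atTop
      (𝓝 (ENNReal.ofReal (∫ x in Qset N, u x * adjApply L₀ φ.1 x))) := by
    refine ENNReal.tendsto_ofReal ?_
    simp only [integral_mul_adjApply _ hu φ.2.1]
    exact tendsto_finsetSum _ fun h _ => tendsto_finsetSum _ fun j _ =>
      tendsto_finsetSum _ fun j' _ => (tendsto_coeff_of_opDist hL h j' j).mul_const _
  rw [← hlim.liminf_eq]
  exact liminf_le_liminf <| Eventually.of_forall fun n => le_iSup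
    (fun ψ : {ψ : (Fin N → ℝ) → Kidx N d → ℝ // IsTest ψ ∧ ∀ x, sqNorm (ψ x) ≤ 1} =>
      ENNReal.ofReal (∫ x in Qset N, u x * adjApply (L n) ψ.1 x)) φ

end
end
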